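/- Let p be a prime and k ≥ 4 an integer, and assume the disjoint-cycles bound holds for every integer k' with 3 ≤ k' < k. Write C = C_{p,k}. Let τ be a real number with 0 < τ < 1/2 such that t^C (log₂(1/t))^{2C} < 2^{−6kC} C^{−2C} for all 0 < t < τ and such that the function t ↦ t (log₂(1/t))^{2C} is monotonically increasing on the interval (0,τ). Then for every 0 < ε < τ, every positive integer n, and all X_1,…,X_k ⊆ F_p^n containing a collection of at least εN pairwise disjoint k-cycles, the total number of k-cycles in X_1×⋯×X_k is at least 2^{−6kC} C^{−2C} ε^C (log₂(1/ε))^{−2C} N^{k−1}. -/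

import Mathlib

open scoped Classical

/-- The set of k-cycles in X 0 x ... x X (k-1): tuples with i-th coordinate in X i
summing to zero. -/
noncomputable def cycleSet {V : Type} [AddCommGroup V] [Fintype V] (k : ℕ)
    (X : Fin k → Finset V) : Finset (Fin k → V) :=
  (Fintype.piFinset X).filter fun x => ∑ i, x i = 0

/-- The constant c_{p,3} ∈ (0,1), defined by
inf_{0<t<1} (t^0 + ... + t^(p-1)) / t^((p-1)/3) = p^(1 - c_{p,3}). -/
noncomputable def cp3 (p : ℕ) : ℝ :=
  1 - Real.logb p (sInf ((fun t : ℝ =>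
    (∑ j ∈ Finset.range p, t ^ j) / t ^ (((p : ℝ) - 1) / 3)) '' Set.Ioo 0 1))

/-- The constant C_{p,k} = (k-2)/c_{p,3} + 1. -/
noncomputable def Cconst (p k : ℕ) : ℝ := ((k : ℝ) - 2) / cp3 p + 1

theorem card_mul_log_le_sum_log_card_fiber {α β : Type*} (s : Finset α) (f : α → β)
    (hs : s.Nonempty) {m : ℝ} (hm : ((s.image f).card : ℝ) ≤ m) :
    (s.card : ℝ) * Real.log (s.card / m) ≤
      ∑ c ∈ s, Real.log ((s.filter fun c' => f c' = f c).card : ℝ) := by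
  have hfib : ∀ c ∈ s, 0 < ((s.filter fun c' => f c' = f c).card : ℝ) := fun c hc => by
    exact_mod_cast Finset.card_pos.2 ⟨c, by simp [hc]⟩
  have hs0 : (0 : ℝ) < s.card := by exact_mod_cast hs.card_pos
  have hm0 : 0 < m := lt_of_lt_of_le (by exact_mod_cast (hs.image f).card_pos) hm
  have hinv : ∑ c ∈ s, ((s.filter fun c' => f c' = f c).card : ℝ)⁻¹ ≤ m := by
    refine le_trans (le_of_eq ?_) hm
    rw [Finset.sum_comp (fun b => ((s.filter fun c' => f c' = b).card : ℝ)⁻¹) f]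
    rw [Finset.cast_card]
    refine Finset.sum_congr rfl fun b hb => ?_
    obtain ⟨c, hc, rfl⟩ := Finset.mem_image.1 hb
    simp [(hfib c hc).ne']
  have hterm : ∀ c ∈ s, Real.log (s.card / m) +
      (1 - s.card / m * ((s.filter fun c' => f c' = f c).card : ℝ)⁻¹) ≤
      Real.log ((s.filter fun c' => f c' = f c).card : ℝ) := fun c hc => by
    have h1 := Real.log_le_sub_one_of_pos (x := s.card / m *
      ((s.filter fun c' => f c' = f c).card : ℝ)⁻¹) (mul_pos (div_pos hs0 hm0)
        (inv_pos.2 (hfib c hc)))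
    rw [Real.log_mul (div_pos hs0 hm0).ne' (inv_pos.2 (hfib c hc)).ne', Real.log_inv] at h1
    linarith
  refine le_trans ?_ (Finset.sum_le_sum hterm)
  simp only [Finset.sum_add_distrib, Finset.sum_sub_distrib, Finset.sum_const, nsmul_eq_mul,
    ← Finset.mul_sum, mul_one]
  have h2 := mul_le_mul_of_nonneg_left hinv (div_pos hs0 hm0).le
  rw [div_mul_cancel₀ _ hm0.ne'] at h2
  linarith

theorem sum_log_card_fiber_add_sum_log_le {α β : Type*} (s : Finset α) (f : α → β)
    (w : α → ℝ) (hw : ∀ c ∈ s, 0 < w c) :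
    ∑ c ∈ s, Real.log ((s.filter fun c' => f c' = f c).card : ℝ) + ∑ c ∈ s, Real.log (w c) ≤
      ∑ c ∈ s, Real.log (∑ c' ∈ s.filter fun c' => f c' = f c, w c') := by
  set a : β → ℝ := fun b => ((s.filter fun c' => f c' = b).card : ℝ) with ha
  set W : β → ℝ := fun b => ∑ c' ∈ s.filter (fun c' => f c' = b), w c' with hW
  have ha0 : ∀ c ∈ s, 0 < a (f c) := fun c hc =>
    Nat.cast_pos.2 (Finset.card_pos.2 ⟨c, by simp [hc]⟩)
  have hW0 : ∀ c ∈ s, 0 < W (f c) := fun c hc =>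
    Finset.sum_pos (fun c' hc' => hw c' (Finset.mem_filter.1 hc').1) ⟨c, by simp [hc]⟩
  have hratio : ∑ c ∈ s, a (f c) * w c / W (f c) = s.card := by
    rw [← Finset.sum_fiberwise_of_maps_to (t := s.image f) (g := f)
      (fun c hc => Finset.mem_image_of_mem f hc)]
    rw [Finset.card_eq_sum_card_image f s, Nat.cast_sum]
    refine Finset.sum_congr rfl fun b hb => ?_
    obtain ⟨c, hc, rfl⟩ := Finset.mem_image.1 hb
    have : ∀ c' ∈ s.filter (fun c' => f c' = f c), a (f c') * w c' / W (f c') =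
        a (f c) / W (f c) * w c' := fun c' hc' => by
      rw [(Finset.mem_filter.1 hc').2]; ring
    rw [Finset.sum_congr rfl this, ← Finset.mul_sum]
    exact div_mul_cancel₀ _ (hW0 c hc).ne'
  have hterm : ∀ c ∈ s, Real.log (a (f c)) + Real.log (w c) +
      (1 - a (f c) * w c / W (f c)) ≤ Real.log (W (f c)) := fun c hc => by
    have h1 := Real.log_le_sub_one_of_pos (x := a (f c) * w c / W (f c))
      (div_pos (mul_pos (ha0 c hc) (hw c hc)) (hW0 c hc))
    rw [Real.log_div (mul_pos (ha0 c hc) (hw c hc)).ne' (hW0 c hc).ne',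
      Real.log_mul (ha0 c hc).ne' (hw c hc).ne'] at h1
    linarith
  have h := Finset.sum_le_sum hterm
  simp only [Finset.sum_add_distrib, Finset.sum_sub_distrib, Finset.sum_const, nsmul_eq_mul,
    mul_one, hratio, sub_self, add_zero] at h
  exact h

/-- Two tuples with the same sum that agree away from one coordinate are equal. -/
theorem eq_of_sum_eq {V : Type*} [AddCommGroup V] {k : ℕ} {c c' : Fin k → V} (o : Fin k) (hsum : ∑ i, c i = ∑ i, c' i)
    (h : ∀ i, i ≠ o → c i = c' i) : c = c' := by
  have h1 : c o = c' o := by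
    rw [← Finset.add_sum_erase _ _ (Finset.mem_univ o),
      ← Finset.add_sum_erase _ c' (Finset.mem_univ o),
      Finset.sum_congr rfl fun i hi => h i (Finset.ne_of_mem_erase hi)] at hsum
    exact add_right_cancel hsum
  funext i
  by_cases hi : i = o
  · rw [hi, h1]
  · exact h i hi

/-- Every coordinate of two distinct members of `D` differs. -/
def PairwiseDisjointCycles {V : Type*} {k : ℕ} (D : Finset (Fin k → V)) : Prop :=
  ∀ c ∈ D, ∀ c' ∈ D, c ≠ c' → ∀ i, c i ≠ c' i

theorem PairwiseDisjointCycles.mono {V : Type*} {k : ℕ} {D E : Finset (Fin k → V)} (hD : PairwiseDisjointCycles D)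
    (h : E ⊆ D) : PairwiseDisjointCycles E :=
  fun c hc c' hc' => hD c (h hc) c' (h hc')

theorem PairwiseDisjointCycles.eq_of_apply_eq {V : Type*} {k : ℕ} {D : Finset (Fin k → V)}
    (hD : PairwiseDisjointCycles D) {c c' : Fin k → V} (hc : c ∈ D) (hc' : c' ∈ D) {i : Fin k}
    (h : c i = c' i) : c = c' := by
  by_contra hne
  exact hD c hc c' hc' hne i h

/-- The box spanned by the coordinates of the tuples in `D`. -/
noncomputable def spanBox {V : Type*} {k : ℕ} (D : Finset (Fin k → V)) (i : Fin k) : Finset V := D.image fun c => c i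

theorem spanBox_mono {V : Type*} {k : ℕ} {D E : Finset (Fin k → V)} (h : D ⊆ E) (i : Fin k) :
    spanBox D i ⊆ spanBox E i := Finset.image_subset_image h

section Cycles

variable {V : Type} [AddCommGroup V] [Fintype V] {k : ℕ}

theorem mem_cycleSet {X : Fin k → Finset V} {x : Fin k → V} :
    x ∈ cycleSet k X ↔ (∀ i, x i ∈ X i) ∧ ∑ i, x i = 0 := by
  simp [cycleSet]

theorem cycleSet_mono {X Y : Fin k → Finset V} (h : ∀ i, X i ⊆ Y i) :
    cycleSet k X ⊆ cycleSet k Y := fun x hx => by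
  rw [mem_cycleSet] at hx ⊢
  exact ⟨fun i => h i (hx.1 i), hx.2⟩

theorem sum_log_card_agree_le (X : Fin k → Finset V) (o : Fin k) (S : Finset (Fin k))
    (hS : o ∉ S) :
    ∑ j ∈ S, ∑ c ∈ cycleSet k X, Real.log
      (((cycleSet k X).filter fun c' => ∀ i, i ≠ o → i ≠ j → c' i = c i).card : ℝ) ≤
    ∑ c ∈ cycleSet k X, Real.log
      (((cycleSet k X).filter fun c' => ∀ i, i ≠ o → i ∉ S → c' i = c i).card : ℝ) := by
  induction S using Finset.induction_on with
  | empty =>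
    simp only [Finset.sum_empty]
    exact Finset.sum_nonneg fun c _ => Real.log_natCast_nonneg _
  | insert j S hj ih =>
    have ho : o ≠ j ∧ o ∉ S := by simpa using hS
    rw [Finset.sum_insert hj]
    have key := sum_log_card_fiber_add_sum_log_le (cycleSet k X)
      (fun (c : Fin k → V) i => if i = o ∨ i = j then 0 else c i)
      (fun c => (((cycleSet k X).filter fun c' => ∀ i, i ≠ o → i ∉ S → c' i = c i).card : ℝ))
      (fun c hc => by exact_mod_cast Finset.card_pos.2 ⟨c, by simp [hc]⟩)
    have hfib : ∀ c c' : Fin k → V,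
        ((fun i => if i = o ∨ i = j then 0 else c' i) =
          (fun i => if i = o ∨ i = j then 0 else c i)) ↔
        ∀ i, i ≠ o → i ≠ j → c' i = c i := fun c c' => by
      constructor
      · intro h i h1 h2
        have := congrFun h i
        simpa [h1, h2] using this
      · intro h
        funext i
        by_cases h1 : i = o
        · simp [h1]
        · by_cases h2 : i = j
          · simp [h2]
          · simp [h1, h2, h i h1 h2]
    simp only [hfib] at key
    refine le_trans (add_le_add_right (ih ho.2) _) (le_trans key ?_)
    refine Finset.sum_le_sum fun c hc => ?_
    have hpos : 0 < ∑ c' ∈ (cycleSet k X).filter (fun c' => ∀ i, i ≠ o → i ≠ j → c' i = c i),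
        (((cycleSet k X).filter fun c'' => ∀ i, i ≠ o → i ∉ S → c'' i = c' i).card : ℝ) := by
      refine Finset.sum_pos (fun c' hc' => ?_) ⟨c, by simp [hc]⟩
      exact_mod_cast Finset.card_pos.2 ⟨c', by simp [(Finset.mem_filter.1 hc').1]⟩
    refine Real.log_le_log hpos ?_
    rw [← Nat.cast_sum, ← Finset.card_biUnion]
    · norm_cast
      refine Finset.card_le_card fun x hx => ?_
      simp only [Finset.mem_biUnion, Finset.mem_filter] at hx ⊢
      obtain ⟨c', ⟨-, hc'⟩, hx, hxc⟩ := hx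
      refine ⟨hx, fun i hi hi' => ?_⟩
      rw [Finset.mem_insert, not_or] at hi'
      rw [hxc i hi hi'.2, hc' i hi hi'.1]
    · intro a ha b hb hab
      rw [Function.onFun, Finset.disjoint_left]
      intro x hxa hxb
      simp only [Finset.coe_filter, Set.mem_ofPred_eq, Finset.mem_filter] at ha hb hxa hxb
      refine hab (eq_of_sum_eq o ?_ fun i hi => ?_)
      · rw [(mem_cycleSet.1 ha.1).2, (mem_cycleSet.1 hb.1).2]
      · by_cases hij : i = j
        · subst hij
          rw [← hxa.2 i hi hj, ← hxb.2 i hi hj]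
        · rw [ha.2 i hi hij, hb.2 i hi hij]

theorem sum_prod_card_fiber_le (X : Fin k → Finset V) {o l : Fin k}
    (J : Finset (Fin k)) (hJ : ∀ j, j ∈ J ↔ j ≠ o ∧ j ≠ l) (v : V) :
    ∑ c ∈ (cycleSet k X).filter (fun c => c o = v), ∏ j ∈ J,
      ((cycleSet k X).filter fun c' => c' o = v ∧ c' j = c j).card ≤
    ((cycleSet k X).filter fun c => c o = v).card ^ J.card := by
  set s := (cycleSet k X).filter fun c => c o = v with hs
  set b : Fin k → V → ℕ := fun j x => ((cycleSet k X).filter fun c' => c' o = v ∧ c' j = x).card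
    with hb
  have hinj : Set.InjOn (fun (c : Fin k → V) (j : J) => c j) (s : Set (Fin k → V)) := by
    intro c hc c' hc' h
    simp only [hs, Finset.coe_filter, Set.mem_ofPred_eq] at hc hc'
    refine eq_of_sum_eq l ?_ fun i hi => ?_
    · rw [(mem_cycleSet.1 hc.1).2, (mem_cycleSet.1 hc'.1).2]
    · by_cases hio : i = o
      · rw [hio, hc.2, hc'.2]
      · exact congrFun h ⟨i, (hJ i).2 ⟨hio, hi⟩⟩
  have hmarg : ∀ j, ∑ x : V, b j x = s.card := fun j => by
    rw [Finset.card_eq_sum_card_fiberwise (f := fun c => c j) (t := Finset.univ)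
      (fun _ _ => Finset.mem_univ _)]
    refine Finset.sum_congr rfl fun x _ => ?_
    rw [hs, Finset.filter_filter]
  calc ∑ c ∈ s, ∏ j ∈ J, b j (c j)
      = ∑ c ∈ s, (fun x : J → V => ∏ j : J, b j (x j)) (fun j : J => c j) :=
        Finset.sum_congr rfl fun c _ => (Finset.prod_coe_sort J fun j => b j (c j)).symm
    _ = ∑ x ∈ s.image (fun (c : Fin k → V) (j : J) => c j), ∏ j : J, b j (x j) :=
        (Finset.sum_image (f := fun x : J → V => ∏ j : J, b j (x j)) hinj).symm
    _ ≤ ∑ x ∈ Fintype.piFinset (fun _ : J => (Finset.univ : Finset V)), ∏ j : J, b j (x j) :=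
        Finset.sum_le_sum_of_subset fun x _ => by simp
    _ = s.card ^ J.card := by
        rw [← Finset.prod_univ_sum]
        simp [hmarg]

theorem sum_log_card_fiber_le (X : Fin k → Finset V) {o l : Fin k}
    (J : Finset (Fin k)) (hJ : ∀ j, j ∈ J ↔ j ≠ o ∧ j ≠ l) (hJ0 : 0 < J.card) {Δ : ℝ}
    (hΔ : 0 < Δ)
    (hdeg : ∀ v, (((cycleSet k X).filter fun c => c o = v).card : ℝ) ≤ Δ) :
    ∑ j ∈ J, ∑ c ∈ cycleSet k X, Real.log
      (((cycleSet k X).filter fun c' => c' o = c o ∧ c' j = c j).card : ℝ) ≤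
    (cycleSet k X).card * ((J.card - 1 : ℝ) * Real.log Δ) := by
  set P : (Fin k → V) → ℝ := fun c => ∏ j ∈ J,
    (((cycleSet k X).filter fun c' => c' o = c o ∧ c' j = c j).card : ℝ) with hP
  have hb : ∀ c ∈ cycleSet k X, ∀ j,
      (0 : ℝ) < ((cycleSet k X).filter fun c' => c' o = c o ∧ c' j = c j).card :=
    fun c hc j => by exact_mod_cast Finset.card_pos.2 ⟨c, by simp [hc]⟩
  obtain ⟨r, hr⟩ : ∃ r, J.card = r + 1 := ⟨J.card - 1, by omega⟩
  have hsum : ∑ c ∈ cycleSet k X, P c ≤ (cycleSet k X).card * Δ ^ r := by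
    rw [← Finset.sum_fiberwise_of_maps_to (t := Finset.univ) (g := fun c : Fin k → V => c o)
      (fun _ _ => Finset.mem_univ _)]
    rw [Finset.card_eq_sum_card_fiberwise (f := fun c : Fin k → V => c o) (t := Finset.univ)
      (fun _ _ => Finset.mem_univ _), Nat.cast_sum, Finset.sum_mul]
    refine Finset.sum_le_sum fun v _ => ?_
    have h1 := sum_prod_card_fiber_le X J hJ v
    have h2 : ∑ c ∈ (cycleSet k X).filter (fun c => c o = v), P c =
        ((∑ c ∈ (cycleSet k X).filter (fun c => c o = v), ∏ j ∈ J,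
      ((cycleSet k X).filter fun c' => c' o = v ∧ c' j = c j).card : ℕ) : ℝ) := by
      push_cast
      refine Finset.sum_congr rfl fun c hc => ?_
      rw [hP, ← (Finset.mem_filter.1 hc).2]
    rw [h2]
    refine le_trans (Nat.cast_le.2 h1) ?_
    rw [hr, pow_succ, Nat.cast_mul, Nat.cast_pow, mul_comm]
    gcongr
    exact hdeg v
  have hΔr : 0 < Δ ^ r := pow_pos hΔ r
  rw [Finset.sum_comm]
  have hterm : ∀ c ∈ cycleSet k X, ∑ j ∈ J, Real.log
      (((cycleSet k X).filter fun c' => c' o = c o ∧ c' j = c j).card : ℝ) ≤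
      r * Real.log Δ + (P c / Δ ^ r - 1) := fun c hc => by
    have hPc : 0 < P c := Finset.prod_pos fun j _ => hb c hc j
    rw [← Real.log_prod fun j _ => (hb c hc j).ne']
    have h1 := Real.log_le_sub_one_of_pos (div_pos hPc hΔr)
    rw [Real.log_div hPc.ne' hΔr.ne', Real.log_pow] at h1
    linarith
  refine le_trans (Finset.sum_le_sum hterm) ?_
  simp only [Finset.sum_add_distrib, Finset.sum_sub_distrib, Finset.sum_const, nsmul_eq_mul,
    ← Finset.sum_div, mul_one]
  have h3 := (div_le_iff₀ hΔr).2 hsum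
  rw [hr]
  push_cast
  rw [add_sub_cancel_right]
  linarith

theorem card_filter_add_eq_le (X : Fin k → Finset V) {o j : Fin k} (hoj : o ≠ j)
    {c : Fin k → V} (hc : c ∈ cycleSet k X) :
    ((cycleSet k X).filter fun c' => c' o + c' j = c o + c j).card ≤
    ((cycleSet k X).filter fun c' => ∀ i, i ≠ o → i ≠ j → c' i = c i).card *
    ((cycleSet k X).filter fun c' => c' o = c o ∧ c' j = c j).card := by
  rw [← Finset.card_product]
  have hmix : ∀ x ∈ cycleSet k X, ∀ y ∈ cycleSet k X, x o + x j = y o + y j →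
      (fun i => if i = o ∨ i = j then x i else y i) ∈ cycleSet k X := by
    intro x hx y hy h
    rw [mem_cycleSet] at hx hy ⊢
    refine ⟨fun i => ?_, ?_⟩
    · split_ifs
      exacts [hx.1 i, hy.1 i]
    · rw [← hy.2, ← sub_eq_zero, ← Finset.sum_sub_distrib]
      have : ∀ i, (if i = o ∨ i = j then x i else y i) - y i =
          (if i = o then x o - y o else 0) + (if i = j then x j - y j else 0) := fun i => by
        by_cases h1 : i = o
        · subst h1; simp [hoj]
        · by_cases h2 : i = j
          · subst h2; simp [h1]
          · simp [h1, h2]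
      simp only [this, Finset.sum_add_distrib, Finset.sum_ite_eq', Finset.mem_univ, if_true]
      rw [sub_add_sub_comm, h, sub_self]
  refine Finset.card_le_card_of_injOn
    (fun x => (fun i => if i = o ∨ i = j then x i else c i,
      fun i => if i = o ∨ i = j then c i else x i)) (fun x hx => ?_) ?_
  · simp only [Finset.coe_filter, Set.mem_ofPred_eq] at hx
    simp only [Finset.coe_product, Finset.coe_filter, Set.mem_prod, Set.mem_ofPred_eq]
    exact ⟨⟨hmix x hx.1 c hc hx.2, fun i h1 h2 => by simp [h1, h2]⟩,
      hmix c hc x hx.1 hx.2.symm, by simp, by simp⟩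
  · intro x _ y _ h
    simp only [Prod.mk.injEq] at h
    funext i
    by_cases hi : i = o ∨ i = j
    · simpa [hi] using congrFun h.1 i
    · simpa [hi] using congrFun h.2 i

/-- If the sums `x o + x j` take few values on the `k`-cycles for every `j ≠ o, l`, then some
element is contained in many `k`-cycles. -/
theorem card_cycleSet_le_mul (X : Fin k → Finset V) {o l : Fin k} (hol : o ≠ l) (hk : 3 ≤ k)
    (hX : (cycleSet k X).Nonempty) {Δ m : ℝ}
    (hdo : ∀ v, (((cycleSet k X).filter fun c => c o = v).card : ℝ) ≤ Δ)
    (hdl : ∀ v, (((cycleSet k X).filter fun c => c l = v).card : ℝ) ≤ Δ)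
    (hm : ∀ j, j ≠ o → j ≠ l → (((cycleSet k X).image fun c => c o + c j).card : ℝ) ≤ m) :
    ((cycleSet k X).card : ℝ) ≤ m * Δ := by
  set T := cycleSet k X with hT
  set J : Finset (Fin k) := Finset.univ.filter fun j => j ≠ o ∧ j ≠ l with hJdef
  have hJ : ∀ j, j ∈ J ↔ j ≠ o ∧ j ≠ l := fun j => by simp [hJdef]
  have hJ0 : 0 < J.card := by
    have h1 : J = (Finset.univ.erase o).erase l := by
      ext j; simp [hJ, and_comm]
    rw [h1, Finset.card_erase_of_mem (by simp [hol.symm]), Finset.card_erase_of_mem (by simp)]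
    simp; omega
  obtain ⟨x, hx⟩ := hX
  have hΔ : 0 < Δ := lt_of_lt_of_le
    (by exact_mod_cast Finset.card_pos.2 ⟨x, by simp [hx]⟩) (hdo (x o))
  have hT0 : (0 : ℝ) < T.card := by exact_mod_cast Finset.card_pos.2 ⟨x, hx⟩
  have hm0 : 0 < m := by
    obtain ⟨j, hj⟩ := Finset.card_pos.1 hJ0
    refine lt_of_lt_of_le ?_ (hm j ((hJ j).1 hj).1 ((hJ j).1 hj).2)
    exact_mod_cast (Finset.Nonempty.image ⟨x, hx⟩ _).card_pos
  have hA : ∑ j ∈ J, ∑ c ∈ T, Real.log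
      ((T.filter fun c' => ∀ i, i ≠ o → i ≠ j → c' i = c i).card : ℝ) ≤
      T.card * Real.log Δ := by
    refine le_trans (sum_log_card_agree_le X o J (by simp [hJ])) ?_
    rw [← nsmul_eq_mul]
    refine Finset.sum_le_card_nsmul _ _ _ fun c hc => ?_
    refine Real.log_le_log (by exact_mod_cast Finset.card_pos.2 ⟨c, by simpa using hc⟩) ?_
    refine le_trans ?_ (hdl (c l))
    norm_cast
    refine Finset.card_le_card fun c' hc' => ?_
    rw [Finset.mem_filter] at hc' ⊢
    exact ⟨hc'.1, hc'.2 l hol.symm (by simp [hJ])⟩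
  have hB := sum_log_card_fiber_le X J hJ hJ0 hΔ hdo
  have hL : ∑ j ∈ J, (T.card : ℝ) * Real.log (T.card / m) ≤ ∑ j ∈ J, (∑ c ∈ T, Real.log
      ((T.filter fun c' => ∀ i, i ≠ o → i ≠ j → c' i = c i).card : ℝ) + ∑ c ∈ T, Real.log
      ((T.filter fun c' => c' o = c o ∧ c' j = c j).card : ℝ)) := by
    refine Finset.sum_le_sum fun j hj => ?_
    have hj' := (hJ j).1 hj
    refine le_trans (card_mul_log_le_sum_log_card_fiber T (fun c => c o + c j) ⟨x, hx⟩
      (hm j hj'.1 hj'.2)) ?_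
    rw [← Finset.sum_add_distrib]
    refine Finset.sum_le_sum fun c hc => ?_
    have h1 : 0 < (T.filter fun c' => ∀ i, i ≠ o → i ≠ j → c' i = c i).card :=
      Finset.card_pos.2 ⟨c, by simp [hc]⟩
    have h2 : 0 < (T.filter fun c' => c' o = c o ∧ c' j = c j).card :=
      Finset.card_pos.2 ⟨c, by simp [hc]⟩
    rw [← Real.log_mul (by positivity) (by positivity)]
    refine Real.log_le_log (by exact_mod_cast Finset.card_pos.2 ⟨c, by simp [hc]⟩) ?_
    exact_mod_cast card_filter_add_eq_le X hj'.1.symm hc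
  rw [Finset.sum_add_distrib, Finset.sum_const, nsmul_eq_mul] at hL
  have hJ0' : (0 : ℝ) < J.card := by exact_mod_cast hJ0
  have hfin : (J.card * T.card : ℝ) * Real.log (T.card / m) ≤ (J.card * T.card) * Real.log Δ := by
    rw [← hT] at hB
    nlinarith [hL, hA, hB]
  have h4 := le_of_mul_le_mul_left hfin (by positivity)
  rw [Real.log_le_log_iff (by positivity) hΔ, div_le_iff₀ hm0] at h4
  linarith

theorem card_filter_degree_mul_le {D : Finset (Fin k → V)} (hD : PairwiseDisjointCycles D)
    (X : Fin k → Finset V) (i : Fin k) (L : ℝ) :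
    ((D.filter fun c => L < ((cycleSet k X).filter fun c' => c' i = c i).card).card : ℝ) * L ≤
      (cycleSet k X).card := by
  set E := D.filter fun c => L < ((cycleSet k X).filter fun c' => c' i = c i).card with hE
  have h1 : (E.card : ℝ) * L ≤
      ∑ c ∈ E, (((cycleSet k X).filter fun c' => c' i = c i).card : ℝ) := by
    rw [← nsmul_eq_mul]
    exact Finset.card_nsmul_le_sum _ _ _ fun c hc => (Finset.mem_filter.1 hc).2.le
  refine h1.trans ?_
  rw [← Nat.cast_sum, ← Finset.card_biUnion]
  · norm_cast
    exact Finset.card_le_card fun x hx => by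
      obtain ⟨c, -, hx⟩ := Finset.mem_biUnion.1 hx
      exact (Finset.mem_filter.1 hx).1
  · intro c hc c' hc' hne
    rw [Function.onFun, Finset.disjoint_left]
    intro x hx hx'
    exact hD c (Finset.mem_filter.1 hc).1 c' (Finset.mem_filter.1 hc').1 hne i
      ((Finset.mem_filter.1 hx).2.symm.trans (Finset.mem_filter.1 hx').2)

theorem subset_cycleSet_spanBox {D : Finset (Fin k → V)} (h0 : ∀ c ∈ D, ∑ i, c i = 0) :
    D ⊆ cycleSet k (spanBox D) := fun c hc =>
  mem_cycleSet.2 ⟨fun _ => Finset.mem_image_of_mem _ hc, h0 c hc⟩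

theorem exists_maximal_disjoint_cycles (X : Fin k → Finset V) (y : (Fin k → V) → V) :
    ∃ M ⊆ cycleSet k X, PairwiseDisjointCycles M ∧ Set.InjOn y (M : Set (Fin k → V)) ∧
      ∀ c ∈ cycleSet k X, (∃ c' ∈ M, ∃ i, c i = c' i) ∨ y c ∈ M.image y := by
  obtain ⟨M, hM, hmax⟩ := Finset.exists_max_image
    ((cycleSet k X).powerset.filter fun M => PairwiseDisjointCycles M ∧
      Set.InjOn y (M : Set (Fin k → V))) Finset.card
    ⟨∅, Finset.mem_filter.2 ⟨by simp, by simp [PairwiseDisjointCycles], by simp⟩⟩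
  simp only [Finset.mem_filter, Finset.mem_powerset] at hM hmax
  refine ⟨M, hM.1, hM.2.1, hM.2.2, fun c hc => ?_⟩
  by_contra! hcon
  obtain ⟨h1, h2⟩ := hcon
  have hcM : c ∉ M := fun h => h2 (Finset.mem_image_of_mem y h)
  have h3 := hmax (insert c M) ⟨Finset.insert_subset hc hM.1, ?_, ?_⟩
  · rw [Finset.card_insert_of_notMem hcM] at h3
    omega
  · intro a ha b hb hab i
    rw [Finset.mem_insert] at ha hb
    rcases ha with rfl | ha <;> rcases hb with rfl | hb
    · exact absurd rfl hab
    · exact h1 b hb i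
    · exact (h1 a ha i).symm
    · exact hM.2.1 a ha b hb hab i
  · rw [Finset.coe_insert, Set.injOn_insert (by simpa using hcM)]
    refine ⟨hM.2.2, ?_⟩
    rwa [← Finset.coe_image, Finset.mem_coe]

/-- If `D` minimizes the number of spanned cycles relative to `|D| ^ C`, then a positive
proportion of disjoint cycles can be found for which moreover the sums of two
coordinates are distinct. -/
theorem exists_disjoint_cycles_injOn_add (hk : 3 ≤ k) {D : Finset (Fin k → V)} (hD0 : D.Nonempty)
    (hD : PairwiseDisjointCycles D) (hsum : ∀ c ∈ D, ∑ i, c i = 0) {C : ℝ} (hC : 1 ≤ C)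
    (hmin : ∀ E ⊆ D, E.Nonempty → ((cycleSet k (spanBox D)).card : ℝ) *
      ((E.card : ℝ) / D.card) ^ C ≤ (cycleSet k (spanBox E)).card)
    {o l : Fin k} (hol : o ≠ l) :
    ∃ j, j ≠ o ∧ j ≠ l ∧ ∃ M ⊆ cycleSet k (spanBox D), PairwiseDisjointCycles M ∧
      Set.InjOn (fun c => c o + c j) (M : Set (Fin k → V)) ∧
      (D.card : ℝ) / (4 * C * k ^ 2) ≤ M.card := by
  by_contra! hcon
  choose M hMsub hMdis hMinj hMmax using fun j : Fin k =>
    exists_maximal_disjoint_cycles (spanBox D) fun c => c o + c j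
  set T := cycleSet k (spanBox D) with hT
  set d : ℝ := (D.card : ℝ) with hd
  have hd0 : 0 < d := by rw [hd]; exact_mod_cast hD0.card_pos
  have hk0 : (3 : ℝ) ≤ k := by exact_mod_cast hk
  have hC0 : 0 < C := by linarith
  set θ : ℝ := d / (4 * C * k ^ 2) with hθ
  have hθ0 : 0 < θ := by positivity
  have hMcard : ∀ j, j ≠ o → j ≠ l → ((M j).card : ℝ) < θ := fun j h1 h2 =>
    hcon j h1 h2 (M j) (hMsub j) (hMdis j) (hMinj j)
  have hT0 : (0 : ℝ) < T.card := by
    exact_mod_cast (hD0.mono (subset_cycleSet_spanBox hsum)).card_pos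
  set L : ℝ := 8 * C * T.card / d with hL
  have hL0 : 0 < L := by positivity
  set Bd : Fin k → Finset (Fin k → V) :=
    fun i => D.filter fun c => L < (T.filter fun c' => c' i = c i).card with hBd
  have hBdcard : ∀ i, ((Bd i).card : ℝ) ≤ d / (8 * C) := fun i => by
    have h1 : ((Bd i).card : ℝ) * L ≤ T.card := card_filter_degree_mul_le hD (spanBox D) i L
    rw [← le_div_iff₀ hL0] at h1
    refine h1.trans (le_of_eq ?_)
    rw [hL]; field_simp
  set J : Finset (Fin k) := Finset.univ.filter fun j => j ≠ o ∧ j ≠ l with hJ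
  set Bm : Finset (Fin k → V) := J.biUnion fun j => Finset.univ.biUnion fun i : Fin k =>
    D.filter fun c => c i ∈ (M j).image fun c' => c' i with hBm
  have hBmcard : (Bm.card : ℝ) ≤ d / (4 * C) := by
    have h1 : ∀ i j, (D.filter fun c => c i ∈ (M j).image fun c' => c' i).card ≤ (M j).card :=
      fun i j => by
      refine le_trans (Finset.card_le_card_of_injOn (fun c => c i)
        (fun c hc => (Finset.mem_filter.1 hc).2) ?_) Finset.card_image_le
      intro c hc c' hc' h
      exact hD.eq_of_apply_eq (Finset.mem_filter.1 hc).1 (Finset.mem_filter.1 hc').1 h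
    have h2 : (Bm.card : ℝ) ≤ ∑ j ∈ J, ∑ i : Fin k, θ := by
      have h3 : Bm.card ≤ ∑ j ∈ J, ∑ i : Fin k, (M j).card :=
        Finset.card_biUnion_le.trans (Finset.sum_le_sum fun j _ =>
          Finset.card_biUnion_le.trans (Finset.sum_le_sum fun i _ => h1 i j))
      refine le_trans (Nat.cast_le.2 h3) ?_
      push_cast
      refine Finset.sum_le_sum fun j hj => Finset.sum_le_sum fun i _ => ?_
      exact (hMcard j (Finset.mem_filter.1 hj).2.1 (Finset.mem_filter.1 hj).2.2).le
    refine h2.trans ?_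
    simp only [Finset.sum_const, Finset.card_univ, Fintype.card_fin, nsmul_eq_mul]
    have h4 : (J.card : ℝ) ≤ k := by
      exact_mod_cast (Finset.card_le_univ J).trans_eq (Fintype.card_fin k)
    calc (J.card : ℝ) * (k * θ) ≤ k * (k * θ) := by gcongr
      _ = d / (4 * C) := by rw [hθ]; field_simp
  set E := D \ (Bd o ∪ Bd l ∪ Bm) with hE
  have hED : E ⊆ D := Finset.sdiff_subset
  have hEcard : d * (1 - 1 / (2 * C)) ≤ E.card := by
    have h1 : (D.card : ℝ) ≤ E.card + ((Bd o).card + (Bd l).card + Bm.card) := by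
      have h2 : D.card ≤ E.card + ((Bd o).card + (Bd l).card + Bm.card) := by
        have h3 : D.card - (Bd o ∪ Bd l ∪ Bm).card ≤ E.card := Finset.le_card_sdiff _ D
        have h4 := Finset.card_union_le (Bd o ∪ Bd l) Bm
        have h5 := Finset.card_union_le (Bd o) (Bd l)
        omega
      exact_mod_cast h2
    have h6 : d * (1 - 1 / (2 * C)) = d - (d / (8 * C) + d / (8 * C) + d / (4 * C)) := by
      field_simp; ring
    rw [h6]
    linarith [hBdcard o, hBdcard l]
  have hC2 : (1 : ℝ) / (2 * C) ≤ 1 / 2 :=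
    one_div_le_one_div_of_le (by norm_num) (by linarith)
  have hE0 : E.Nonempty := by
    have h1 : 0 < (E.card : ℝ) := lt_of_lt_of_le (mul_pos hd0 (by linarith)) hEcard
    exact Finset.card_pos.1 (by exact_mod_cast h1)
  have hTE : (T.card : ℝ) / 2 ≤ (cycleSet k (spanBox E)).card := by
    refine le_trans ?_ (hmin E hED hE0)
    have h1 : (1 : ℝ) / 2 ≤ ((E.card : ℝ) / d) ^ C := by
      have h2 := one_add_mul_self_le_rpow_one_add (s := -(1 / (2 * C))) (by linarith) hC
      have h3 : 1 + C * -(1 / (2 * C)) = 1 / 2 := by field_simp; norm_num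
      rw [h3] at h2
      refine h2.trans (Real.rpow_le_rpow (by linarith) ?_ hC0.le)
      rw [le_div_iff₀ hd0]
      linarith
    calc (T.card : ℝ) / 2 = T.card * (1 / 2) := by ring
      _ ≤ _ := by gcongr
  have hsub : cycleSet k (spanBox E) ⊆ T := cycleSet_mono (spanBox_mono hED)
  have hdeg : ∀ i, i = o ∨ i = l → ∀ v,
      (((cycleSet k (spanBox E)).filter fun c => c i = v).card : ℝ) ≤ L := by
    intro i hi v
    by_cases hv : ∃ c ∈ cycleSet k (spanBox E), c i = v
    · obtain ⟨c, hc, rfl⟩ := hv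
      obtain ⟨e, he, hec⟩ := Finset.mem_image.1 ((mem_cycleSet.1 hc).1 i)
      rw [hE, Finset.mem_sdiff] at he
      have h1 : e ∉ Bd i := by
        rcases hi with rfl | rfl <;> · intro h; exact he.2 (by simp [h])
      have h2 : ((T.filter fun c' => c' i = e i).card : ℝ) ≤ L := by
        by_contra! h; exact h1 (Finset.mem_filter.2 ⟨he.1, h⟩)
      rw [hec] at h2
      refine le_trans ?_ h2
      exact_mod_cast Finset.card_le_card (Finset.filter_subset_filter _ hsub)
    · rw [Finset.filter_eq_empty_iff.2 fun c hc h => hv ⟨c, hc, h⟩]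
      simpa using hL0.le
  have hfin := card_cycleSet_le_mul (spanBox E) hol hk
    (hE0.mono (subset_cycleSet_spanBox fun c hc => hsum c (hED hc)))
    (hdeg o (Or.inl rfl)) (hdeg l (Or.inr rfl)) (m := θ) fun j h1 h2 => by
      refine le_trans ?_ (hMcard j h1 h2).le
      norm_cast
      refine le_trans (Finset.card_le_card ?_)
        (Finset.card_image_le (s := M j) (f := fun c => c o + c j))
      intro y hy
      obtain ⟨c, hc, rfl⟩ := Finset.mem_image.1 hy
      refine (hMmax j c (hsub hc)).resolve_left ?_
      rintro ⟨c', hc', i, hi⟩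
      obtain ⟨e, he, hec⟩ := Finset.mem_image.1 ((mem_cycleSet.1 hc).1 i)
      rw [hE, Finset.mem_sdiff] at he
      refine he.2 (Finset.mem_union_right _ ?_)
      simp only [hBm, Finset.mem_biUnion, Finset.mem_filter, Finset.mem_univ, true_and]
      exact ⟨j, by simp [hJ, h1, h2], i, he.1, Finset.mem_image.2 ⟨c', hc', by
        rw [← hi]; exact hec.symm⟩⟩
  have h5 : θ * L = 2 * T.card / k ^ 2 := by
    rw [hθ, hL]; field_simp; norm_num
  rw [h5] at hfin
  have h6 : (T.card : ℝ) / 2 ≤ 2 * T.card / k ^ 2 := hTE.trans hfin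
  rw [div_le_div_iff₀ (by norm_num) (by positivity)] at h6
  have h7 : (3 : ℝ) ^ 2 ≤ (k : ℝ) ^ 2 := by gcongr
  nlinarith [mul_le_mul_of_nonneg_left h7 hT0.le]

theorem sum_update_singleton_card (W : Fin k → Finset V) (j : Fin k) (Y : Finset V) :
    (cycleSet k (Function.update W j Y)).card =
      ∑ y ∈ Y, (cycleSet k (Function.update W j {y})).card := by
  rw [Finset.card_eq_sum_card_fiberwise (f := fun c : Fin k → V => c j) (t := Y)
    fun c hc => by simpa using (mem_cycleSet.1 hc).1 j]
  refine Finset.sum_congr rfl fun y hy => congrArg Finset.card ?_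
  ext c
  simp only [Finset.mem_filter, mem_cycleSet]
  constructor
  · rintro ⟨⟨h1, h2⟩, rfl⟩
    refine ⟨fun i => ?_, h2⟩
    have := h1 i
    by_cases hi : i = j
    · subst hi; simp
    · simpa [hi] using this
  · rintro ⟨h1, h2⟩
    have hy' : c j = y := by simpa using h1 j
    refine ⟨⟨fun i => ?_, h2⟩, hy'⟩
    have := h1 i
    by_cases hi : i = j
    · subst hi; simpa [hy'] using hy
    · simpa [hi] using this

/-- If the lower bound for the number of cycles holds in `V` for a given exponent, then in a
family of disjoint cycles most of the elements at a given coordinate lie in many cycles. -/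
theorem card_filter_unpopular_lt {N C' : ℝ} (hN : N = Fintype.card V) (hk : 2 ≤ k)
    (H : ∀ ε : ℝ, 0 < ε → ε < 1 → ∀ X : Fin k → Finset V,
      (∃ D : Finset (Fin k → V), D ⊆ cycleSet k X ∧ PairwiseDisjointCycles D ∧
        ε * N ≤ (D.card : ℝ)) → ε ^ C' * N ^ (k - 1) ≤ ((cycleSet k X).card : ℝ))
    {α : Type*} {M : Finset α} (hM : M.Nonempty) (z : α → Fin k → V)
    (hz : ∀ a ∈ M, ∀ b ∈ M, a ≠ b → ∀ i, z a i ≠ z b i)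
    (W : Fin k → Finset V) (j : Fin k)
    (hW : ∀ a ∈ M, z a ∈ cycleSet k (Function.update W j {z a j})) :
    ((M.filter fun a => ((cycleSet k (Function.update W j {z a j})).card : ℝ) ≤
      (M.card / (4 * N)) ^ (C' - 1) * N ^ (k - 2) / 8).card : ℝ) < M.card / 4 := by
  set η : ℝ := M.card / (4 * N) with hη
  set A : ℝ := η ^ (C' - 1) * N ^ (k - 2) / 8 with hA
  set S := M.filter fun a => ((cycleSet k (Function.update W j {z a j})).card : ℝ) ≤ A with hS
  by_contra! hcon
  have hinj : Set.InjOn (fun a => z a j) (M : Set α) := fun a ha b hb h => by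
    by_contra hne
    exact hz a ha b hb hne j h
  have hN0 : 0 < N := by rw [hN]; exact_mod_cast Fintype.card_pos
  have hM0 : (0 : ℝ) < M.card := by exact_mod_cast hM.card_pos
  have hMN : (M.card : ℝ) ≤ N := by
    rw [hN]
    exact_mod_cast (Finset.card_image_of_injOn hinj).symm.trans_le (Finset.card_le_univ _)
  have hη0 : 0 < η := by positivity
  have hη1 : η < 1 := by
    rw [hη, div_lt_one (by positivity)]; linarith
  have hSM : S ⊆ M := Finset.filter_subset _ _
  have hηN : η * N = M.card / 4 := by rw [hη]; field_simp
  have hzinj : Set.InjOn z (S : Set α) := fun a ha b hb h =>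
    hinj (hSM ha) (hSM hb) (congrFun h j)
  have h1 := H η hη0 hη1 (Function.update W j (S.image fun a => z a j)) ⟨S.image z, ?_, ?_, ?_⟩
  · rw [sum_update_singleton_card, Finset.sum_image (hinj.mono hSM), Nat.cast_sum] at h1
    have h2 := h1.trans (Finset.sum_le_card_nsmul S _ A fun a ha => (Finset.mem_filter.1 ha).2)
    rw [nsmul_eq_mul] at h2
    have h3 : (S.card : ℝ) ≤ η * N * 4 := by
      rw [hηN]
      have : (S.card : ℝ) ≤ M.card := by exact_mod_cast Finset.card_le_card hSM
      linarith
    have hA0 : 0 < A := by positivity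
    have h4 : η ^ C' * N ^ (k - 1) ≤ η * N * 4 * A :=
      h2.trans (mul_le_mul_of_nonneg_right h3 hA0.le)
    have h5 : η * N * 4 * A = η ^ C' * N ^ (k - 1) / 2 := by
      obtain ⟨q, rfl⟩ : ∃ q, k = q + 2 := ⟨k - 2, by omega⟩
      have h6 : η ^ C' = η ^ (C' - 1) * η := by
        rw [← Real.rpow_add_one hη0.ne', sub_add_cancel]
      rw [h6, hA, show q + 2 - 1 = q + 1 by omega, Nat.add_sub_cancel, pow_succ]
      ring
    have h7 : 0 < η ^ C' * N ^ (k - 1) := by positivity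
    linarith
  · intro c hc
    obtain ⟨a, ha, rfl⟩ := Finset.mem_image.1 hc
    have h2 := mem_cycleSet.1 (hW a (hSM ha))
    refine mem_cycleSet.2 ⟨fun i => ?_, h2.2⟩
    by_cases hi : i = j
    · subst hi
      rw [Function.update_self]
      exact Finset.mem_image_of_mem _ ha
    · simpa [hi] using h2.1 i
  · intro c hc c' hc' hne
    obtain ⟨a, ha, rfl⟩ := Finset.mem_image.1 hc
    obtain ⟨b, hb, rfl⟩ := Finset.mem_image.1 hc'
    exact hz a (hSM ha) b (hSM hb) fun h => hne (h ▸ rfl)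
  · rw [Finset.card_image_of_injOn hzinj, hηN]
    exact hcon

/-- A `3`-cycle and a `k`-cycle sharing an element (up to sign) glue to a `(k + 1)`-cycle. -/
theorem sum_card_mul_card_le (X : Fin (k + 1) → Finset V) (j : Fin k)
    (M : Finset (Fin (k + 1) → V))
    (hinj : Set.InjOn (fun c => c 0 + c j.succ) (M : Set (Fin (k + 1) → V))) :
    ∑ c ∈ M, (cycleSet 3 (Function.update ![X 0, X j.succ, ∅] 2 {-(c 0 + c j.succ)})).card *
      (cycleSet k (Function.update (fun i => X i.succ) j {c 0 + c j.succ})).card ≤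
    (cycleSet (k + 1) X).card := by
  have hmem3 : ∀ {y : V} {u : Fin 3 → V},
      u ∈ cycleSet 3 (Function.update ![X 0, X j.succ, ∅] 2 {-y}) →
      u 0 ∈ X 0 ∧ u 1 ∈ X j.succ ∧ u 2 = -y ∧ u 0 + u 1 = y := by
    intro y u hu
    rw [mem_cycleSet, Fin.sum_univ_three] at hu
    have h0 := hu.1 0
    have h1 := hu.1 1
    have h2 := hu.1 2
    simp only [Function.update_self, Finset.mem_singleton] at h2
    rw [Function.update_of_ne (by decide)] at h0 h1
    refine ⟨by simpa using h0, by simpa using h1, h2, ?_⟩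
    have := hu.2
    rw [h2] at this
    exact add_neg_eq_zero.1 this
  simp only [← Finset.card_product]
  rw [← Finset.card_sigma]
  refine Finset.card_le_card_of_injOn
    (fun t => Fin.cons (t.2.1 0) (Function.update t.2.2 j (t.2.1 1))) ?_ ?_
  · rintro ⟨c, u, w⟩ ht
    simp only [Finset.coe_sigma, Set.mem_sigma_iff, Finset.mem_coe, Finset.mem_product] at ht
    obtain ⟨-, hu, hw⟩ := ht
    obtain ⟨h0, h1, -, hsum⟩ := hmem3 hu
    rw [mem_cycleSet] at hw
    have hwj : w j = c 0 + c j.succ := by simpa using hw.1 j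
    rw [Finset.mem_coe, mem_cycleSet]
    refine ⟨fun i => ?_, ?_⟩
    · refine Fin.cases ?_ (fun i => ?_) i
      · simpa using h0
      · by_cases hi : i = j
        · subst hi; simpa using h1
        · simpa [hi] using hw.1 i
    · rw [Fin.sum_univ_succ]
      simp only [Fin.cons_zero, Fin.cons_succ]
      rw [Finset.sum_update_of_mem (Finset.mem_univ j), ← add_assoc, hsum, ← hwj,
        ← Finset.erase_eq, Finset.add_sum_erase _ _ (Finset.mem_univ j), hw.2]
  · rintro ⟨c, u, w⟩ ht ⟨c', u', w'⟩ ht' h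
    simp only [Finset.coe_sigma, Set.mem_sigma_iff, Finset.mem_coe, Finset.mem_product] at ht ht'
    obtain ⟨hc, hu, hw⟩ := ht
    obtain ⟨hc', hu', hw'⟩ := ht'
    dsimp only at h
    rw [Fin.cons_inj] at h
    obtain ⟨-, -, hu2, hs⟩ := hmem3 hu
    obtain ⟨-, -, hu2', hs'⟩ := hmem3 hu'
    have h1 : u 1 = u' 1 := by simpa using congrFun h.2 j
    have hcc : c = c' := hinj hc hc' (by
      change c 0 + c j.succ = c' 0 + c' j.succ
      rw [← hs, ← hs', h.1, h1])
    subst hcc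
    have hwj : w j = c 0 + c j.succ := by simpa using (mem_cycleSet.1 hw).1 j
    have hwj' : w' j = c 0 + c j.succ := by simpa using (mem_cycleSet.1 hw').1 j
    have huu : u = u' := by
      funext i
      fin_cases i
      exacts [h.1, h1, hu2.trans hu2'.symm]
    have hww : w = w' := by
      funext i
      by_cases hi : i = j
      · rw [hi, hwj, hwj']
      · simpa [hi] using congrFun h.2 i
    rw [huu, hww]

/-- The lower bound for `k + 1` cycles, with a constant factor lost, from a family of disjoint
cycles in which the sums of two coordinates are distinct. -/
theorem le_card_cycleSet_of_injOn_add {N C₃ C' : ℝ} (hN : N = Fintype.card V) (hk : 3 ≤ k)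
    (H₃ : ∀ ε : ℝ, 0 < ε → ε < 1 → ∀ X : Fin 3 → Finset V,
      (∃ D : Finset (Fin 3 → V), D ⊆ cycleSet 3 X ∧ PairwiseDisjointCycles D ∧
        ε * N ≤ (D.card : ℝ)) → ε ^ C₃ * N ^ (3 - 1) ≤ ((cycleSet 3 X).card : ℝ))
    (H : ∀ ε : ℝ, 0 < ε → ε < 1 → ∀ X : Fin k → Finset V,
      (∃ D : Finset (Fin k → V), D ⊆ cycleSet k X ∧ PairwiseDisjointCycles D ∧
        ε * N ≤ (D.card : ℝ)) → ε ^ C' * N ^ (k - 1) ≤ ((cycleSet k X).card : ℝ))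
    (X : Fin (k + 1) → Finset V) (j : Fin k) {M : Finset (Fin (k + 1) → V)} (hM : M.Nonempty)
    (hMX : M ⊆ cycleSet (k + 1) X) (hMd : PairwiseDisjointCycles M)
    (hinj : Set.InjOn (fun c => c 0 + c j.succ) (M : Set (Fin (k + 1) → V))) :
    (M.card / (4 * N)) ^ (C₃ + C' - 1) * N ^ k / 32 ≤ (cycleSet (k + 1) X).card := by
  set η : ℝ := M.card / (4 * N) with hη
  have hN0 : 0 < N := by rw [hN]; exact_mod_cast Fintype.card_pos
  have hM0 : (0 : ℝ) < M.card := by exact_mod_cast hM.card_pos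
  have hη0 : 0 < η := by positivity
  set A : ℝ := η ^ (C₃ - 1) * N ^ (3 - 2) / 8 with hA
  set B : ℝ := η ^ (C' - 1) * N ^ (k - 2) / 8 with hB
  set r : (Fin (k + 1) → V) → ℕ := fun c =>
    (cycleSet 3 (Function.update ![X 0, X j.succ, ∅] 2 {-(c 0 + c j.succ)})).card with hr
  set q : (Fin (k + 1) → V) → ℕ := fun c =>
    (cycleSet k (Function.update (fun i => X i.succ) j {c 0 + c j.succ})).card with hq
  have hne : ∀ a ∈ M, ∀ b ∈ M, a ≠ b → a 0 + a j.succ ≠ b 0 + b j.succ :=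
    fun a ha b hb hab h => hab (hinj ha hb h)
  have h3 : ((M.filter fun c => (r c : ℝ) ≤ A).card : ℝ) < M.card / 4 := by
    refine card_filter_unpopular_lt hN (by norm_num) H₃ hM
      (fun c => ![c 0, c j.succ, -(c 0 + c j.succ)]) ?_ ![X 0, X j.succ, ∅] 2 ?_
    · intro a ha b hb hab i
      fin_cases i
      · exact hMd a ha b hb hab 0
      · exact hMd a ha b hb hab j.succ
      · exact fun h => hne a ha b hb hab (neg_injective h)
    · intro c hc
      have h1 := (mem_cycleSet.1 (hMX hc)).1
      refine mem_cycleSet.2 ⟨fun i => ?_, ?_⟩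
      · fin_cases i
        · simpa using h1 0
        · simpa using h1 j.succ
        · simp
      · rw [Fin.sum_univ_three]; simp
  have h4 : ((M.filter fun c => (q c : ℝ) ≤ B).card : ℝ) < M.card / 4 := by
    have := card_filter_unpopular_lt hN (by omega) H hM
      (fun c => Function.update (fun i => c i.succ) j (c 0 + c j.succ)) ?_
      (fun i => X i.succ) j ?_
    · simpa only [Function.update_self] using this
    · intro a ha b hb hab i
      by_cases hi : i = j
      · subst hi; simpa using hne a ha b hb hab
      · simpa [hi] using hMd a ha b hb hab i.succ
    · intro c hc
      have h1 := mem_cycleSet.1 (hMX hc)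
      refine mem_cycleSet.2 ⟨fun i => ?_, ?_⟩
      · by_cases hi : i = j
        · subst hi; simp
        · simpa [hi] using h1.1 i.succ
      · have h2 := h1.2
        rw [Fin.sum_univ_succ, ← Finset.add_sum_erase _ _ (Finset.mem_univ j),
          ← add_assoc] at h2
        rw [Finset.sum_update_of_mem (Finset.mem_univ j), ← Finset.erase_eq]
        exact h2
  set G := M.filter fun c => A < r c ∧ B < q c with hG
  have hGcard : (M.card : ℝ) / 2 ≤ G.card := by
    have h5 : M ⊆ G ∪ (M.filter (fun c => (r c : ℝ) ≤ A) ∪ M.filter fun c => (q c : ℝ) ≤ B) := by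
      intro c hc
      simp only [hG, Finset.mem_union, Finset.mem_filter, hc, true_and]
      by_cases h1 : (r c : ℝ) ≤ A
      · exact Or.inr (Or.inl h1)
      · by_cases h2 : (q c : ℝ) ≤ B
        · exact Or.inr (Or.inr h2)
        · exact Or.inl ⟨not_le.1 h1, not_le.1 h2⟩
    have h6 := (Finset.card_le_card h5).trans ((Finset.card_union_le _ _).trans
      (add_le_add_right (Finset.card_union_le _ _) _))
    have h7 : (M.card : ℝ) ≤ G.card + ((M.filter fun c => (r c : ℝ) ≤ A).card +
      (M.filter fun c => (q c : ℝ) ≤ B).card) := by exact_mod_cast h6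
    linarith
  have hA0 : 0 < A := by positivity
  have hB0 : 0 < B := by positivity
  have h8 : (G.card : ℝ) * (A * B) ≤ (cycleSet (k + 1) X).card := by
    have h9 : ((∑ c ∈ M, r c * q c : ℕ) : ℝ) ≤ (cycleSet (k + 1) X).card :=
      Nat.cast_le.2 (sum_card_mul_card_le X j M hinj)
    refine le_trans ?_ h9
    push_cast
    refine le_trans ?_ (Finset.sum_le_sum_of_subset_of_nonneg (Finset.filter_subset
      (fun c => A < r c ∧ B < q c) M) fun _ _ _ => by positivity)
    rw [← nsmul_eq_mul]
    refine Finset.card_nsmul_le_sum _ _ _ fun c hc => ?_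
    obtain ⟨-, h1, h2⟩ := Finset.mem_filter.1 hc
    exact mul_le_mul h1.le h2.le hB0.le (hA0.le.trans h1.le)
  refine le_trans (le_of_eq ?_) (le_trans (mul_le_mul_of_nonneg_right hGcard
    (mul_pos hA0 hB0).le) h8)
  obtain ⟨s, rfl⟩ : ∃ s, k = s + 2 := ⟨k - 2, by omega⟩
  have hMη : (M.card : ℝ) = 4 * N * η := by rw [hη]; field_simp
  have hpow : η ^ (C₃ + C' - 1) = η ^ (C₃ - 1) * η ^ (C' - 1) * η := by
    rw [← Real.rpow_add hη0, ← Real.rpow_add_one hη0.ne']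
    congr 1; ring
  rw [hpow, hA, hB, hMη, Nat.add_sub_cancel, pow_succ, pow_succ]
  ring

/-- A subset of `D` minimizing the number of spanned cycles relative to its size. -/
theorem exists_minimal_subset {D : Finset (Fin k → V)} (hD : D.Nonempty) (C : ℝ) :
    ∃ E ⊆ D, E.Nonempty ∧
      ((cycleSet k (spanBox E)).card : ℝ) * ((D.card : ℝ) / E.card) ^ C ≤
        (cycleSet k (spanBox D)).card ∧
      ∀ F ⊆ E, F.Nonempty → ((cycleSet k (spanBox E)).card : ℝ) *
        ((F.card : ℝ) / E.card) ^ C ≤ (cycleSet k (spanBox F)).card := by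
  obtain ⟨E, hE, hmin⟩ := Finset.exists_min_image (D.powerset.filter Finset.Nonempty)
    (fun E => ((cycleSet k (spanBox E)).card : ℝ) / (E.card : ℝ) ^ C)
    ⟨D, by simp [hD]⟩
  simp only [Finset.mem_filter, Finset.mem_powerset] at hE hmin
  have key : ∀ F ⊆ D, F.Nonempty → ((cycleSet k (spanBox E)).card : ℝ) *
      ((F.card : ℝ) / E.card) ^ C ≤ (cycleSet k (spanBox F)).card := by
    intro F hF hF0
    have hFc : (0 : ℝ) < F.card := by exact_mod_cast hF0.card_pos
    have h1 := hmin F ⟨hF, hF0⟩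
    rw [le_div_iff₀ (Real.rpow_pos_of_pos hFc C)] at h1
    rw [Real.div_rpow hFc.le (Nat.cast_nonneg _)]
    refine le_trans (le_of_eq ?_) h1
    ring
  exact ⟨E, hE.1, hE.2, key D subset_rfl hD, fun F hF => key F (hF.trans hE.1)⟩

/-- The lower bound for the number of `(k + 1)`-cycles, with a constant factor lost. -/
theorem le_card_cycleSet {N C₃ C' C : ℝ} (hN : N = Fintype.card V) (hk : 3 ≤ k)
    (H₃ : ∀ ε : ℝ, 0 < ε → ε < 1 → ∀ X : Fin 3 → Finset V,
      (∃ D : Finset (Fin 3 → V), D ⊆ cycleSet 3 X ∧ PairwiseDisjointCycles D ∧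
        ε * N ≤ (D.card : ℝ)) → ε ^ C₃ * N ^ (3 - 1) ≤ ((cycleSet 3 X).card : ℝ))
    (H : ∀ ε : ℝ, 0 < ε → ε < 1 → ∀ X : Fin k → Finset V,
      (∃ D : Finset (Fin k → V), D ⊆ cycleSet k X ∧ PairwiseDisjointCycles D ∧
        ε * N ≤ (D.card : ℝ)) → ε ^ C' * N ^ (k - 1) ≤ ((cycleSet k X).card : ℝ))
    (hC : C = C₃ + C' - 1) (hC1 : 1 ≤ C) {D : Finset (Fin (k + 1) → V)} (hD0 : D.Nonempty)
    {X : Fin (k + 1) → Finset V} (hDX : D ⊆ cycleSet (k + 1) X) (hD : PairwiseDisjointCycles D) :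
    (D.card / (16 * C * (k + 1 : ℕ) ^ 2 * N)) ^ C * N ^ k / 32 ≤ (cycleSet (k + 1) X).card := by
  obtain ⟨E, hED, hE0, hEle, hmin⟩ := exists_minimal_subset hD0 C
  have hsum : ∀ c ∈ D, ∑ i, c i = 0 := fun c hc => (mem_cycleSet.1 (hDX hc)).2
  have hN0 : 0 < N := by rw [hN]; exact_mod_cast Fintype.card_pos
  have hC0 : 0 < C := by linarith
  obtain ⟨j, hj0, -, M, hMsub, hMd, hMinj, hMcard⟩ := exists_disjoint_cycles_injOn_add
    (by omega) hE0 (hD.mono hED) (fun c hc => hsum c (hED hc)) hC1 hmin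
    (o := 0) (l := Fin.last k) (by simp [Fin.ext_iff]; omega)
  obtain ⟨j, rfl⟩ := Fin.exists_succ_eq_of_ne_zero hj0
  have hEc : (0 : ℝ) < E.card := by exact_mod_cast hE0.card_pos
  have hDc : (0 : ℝ) < D.card := by exact_mod_cast hD0.card_pos
  have hM0 : M.Nonempty := by
    have : (0 : ℝ) < M.card := lt_of_lt_of_le (by positivity) hMcard
    exact Finset.card_pos.1 (by exact_mod_cast this)
  have h1 := le_card_cycleSet_of_injOn_add hN hk H₃ H (spanBox E) j hM0 hMsub hMd hMinj
  rw [← hC] at h1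
  have hsub : cycleSet (k + 1) (spanBox D) ⊆ cycleSet (k + 1) X := cycleSet_mono fun i x hx => by
    obtain ⟨c, hc, rfl⟩ := Finset.mem_image.1 hx
    exact (mem_cycleSet.1 (hDX hc)).1 i
  have h2 : ((cycleSet (k + 1) (spanBox D)).card : ℝ) ≤ (cycleSet (k + 1) X).card := by
    exact_mod_cast Finset.card_le_card hsub
  refine le_trans ?_ (hEle.trans h2)
  refine le_trans ?_ (mul_le_mul_of_nonneg_right h1 (by positivity))
  have h3 : (D.card : ℝ) / (16 * C * (k + 1 : ℕ) ^ 2 * N) =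
      (E.card / (4 * C * (k + 1 : ℕ) ^ 2)) / (4 * N) * (D.card / E.card) := by
    field_simp; norm_num
  rw [h3, Real.mul_rpow (by positivity) (by positivity)]
  have h4 : ((E.card / (4 * C * (k + 1 : ℕ) ^ 2)) / (4 * N)) ^ C ≤ (M.card / (4 * N)) ^ C := by
    gcongr
  calc _ = ((E.card / (4 * C * (k + 1 : ℕ) ^ 2)) / (4 * N)) ^ C * (N ^ k / 32) *
        (D.card / E.card) ^ C := by ring
    _ ≤ (M.card / (4 * N)) ^ C * (N ^ k / 32) * (D.card / E.card) ^ C := by gcongr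
    _ = _ := by ring

end Cycles

/-- The disjoint-cycles bound for three sets forces its exponent to be at least two. -/
theorem two_le_of_bound (p : ℕ) [hp : Fact p.Prime] {C₃ : ℝ}
    (H : ∀ ε : ℝ, 0 < ε → ε < 1 → ∀ n' : ℕ, 0 < n' → ∀ X' : Fin 3 → Finset (Fin n' → ZMod p),
      (∃ D : Finset (Fin 3 → (Fin n' → ZMod p)), D ⊆ cycleSet 3 X' ∧
        (∀ c ∈ D, ∀ c' ∈ D, c ≠ c' → ∀ i, c i ≠ c' i) ∧
        ε * (p : ℝ) ^ n' ≤ (D.card : ℝ)) →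
      ε ^ C₃ * ((p : ℝ) ^ n') ^ (3 - 1) ≤ ((cycleSet 3 X').card : ℝ)) : 2 ≤ C₃ := by
  have hp1 : (1 : ℝ) < p := by exact_mod_cast hp.out.one_lt
  have hp0 : (0 : ℝ) < p := by linarith
  have h0 : cycleSet 3 (fun _ => ({0} : Finset (Fin 1 → ZMod p))) = {0} := by
    ext c
    rw [mem_cycleSet, Finset.mem_singleton]
    constructor
    · rintro ⟨h, -⟩
      funext i
      simpa using h i
    · rintro rfl
      simp
  have h1 := H (p : ℝ)⁻¹ (inv_pos.2 hp0) (inv_lt_one_of_one_lt₀ hp1) 1 one_pos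
    (fun _ => {0}) ⟨{0}, by rw [h0], by simp, by simp [hp0.ne']⟩
  rw [h0, Finset.card_singleton, Nat.cast_one, pow_one, Real.inv_rpow hp0.le,
    ← Real.rpow_neg hp0.le, ← Real.rpow_natCast, ← Real.rpow_add hp0] at h1
  by_contra! hlt
  have h2 : (1 : ℝ) < (p : ℝ) ^ (-C₃ + ((3 - 1 : ℕ) : ℝ)) :=
    Real.one_lt_rpow hp1 (by norm_num; linarith)
  linarith

theorem const_rpow_le {k : ℕ} (hk : 4 ≤ k) {C ε : ℝ} (hC : 1 ≤ C) (hε : 0 < ε) :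
    (2 : ℝ) ^ (-(6 * (k : ℝ) * C)) * C ^ (-(2 * C)) * ε ^ C ≤
      (ε / (16 * C * (k : ℝ) ^ 2)) ^ C / 32 := by
  have hC0 : 0 < C := by linarith
  have hk0 : (0 : ℝ) < k := by exact_mod_cast (by omega : 0 < k)
  have h1 : (2 : ℝ) ^ (-(6 * (k : ℝ) * C)) * C ^ (-(2 * C)) * ε ^ C =
      (ε / (2 ^ (6 * k) * C ^ 2)) ^ C := by
    rw [Real.div_rpow hε.le (by positivity), Real.mul_rpow (by positivity) (by positivity),
      ← Real.rpow_natCast, ← Real.rpow_natCast, ← Real.rpow_mul (by norm_num),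
      ← Real.rpow_mul hC0.le, Real.rpow_neg (by norm_num), Real.rpow_neg hC0.le]
    push_cast
    field_simp
  have h2 : (ε / (16 * C * (k : ℝ) ^ 2) / 32) ^ C ≤ (ε / (16 * C * (k : ℝ) ^ 2)) ^ C / 32 := by
    rw [Real.div_rpow (by positivity) (by norm_num)]
    gcongr
    exact Real.self_le_rpow_of_one_le (by norm_num) hC
  rw [h1]
  refine le_trans ?_ h2
  rw [div_div]
  refine Real.rpow_le_rpow (by positivity)
    (div_le_div_of_nonneg_left hε.le (by positivity) ?_) hC0.le
  have hk2 : (k : ℝ) ≤ 2 ^ k := by exact_mod_cast Nat.lt_two_pow_self.le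
  have h512 : (512 : ℝ) ≤ 2 ^ (4 * k) :=
    le_trans (by norm_num) (pow_le_pow_right₀ (by norm_num) (by omega : 9 ≤ 4 * k))
  calc 16 * C * (k : ℝ) ^ 2 * 32 = 512 * (k : ℝ) ^ 2 * C := by ring
    _ ≤ 2 ^ (4 * k) * (2 ^ k) ^ 2 * (C * C) := by
      gcongr
      nlinarith
    _ = 2 ^ (6 * k) * C ^ 2 := by ring

theorem approximate_version (p : ℕ) [hp : Fact p.Prime] (k : ℕ) (hk : 4 ≤ k)
    (H : ∀ k' : ℕ, 3 ≤ k' → k' < k → ∀ ε : ℝ, 0 < ε → ε < 1 →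
      ∀ n' : ℕ, 0 < n' → ∀ X' : Fin k' → Finset (Fin n' → ZMod p),
      (∃ D : Finset (Fin k' → (Fin n' → ZMod p)), D ⊆ cycleSet k' X' ∧
        (∀ c ∈ D, ∀ c' ∈ D, c ≠ c' → ∀ i, c i ≠ c' i) ∧
        ε * (p : ℝ) ^ n' ≤ (D.card : ℝ)) →
      ε ^ Cconst p k' * ((p : ℝ) ^ n') ^ (k' - 1) ≤ ((cycleSet k' X').card : ℝ))
    (C : ℝ) (hC : C = Cconst p k)
    (τ : ℝ) (hτ0 : 0 < τ) (hτhalf : τ < 1 / 2)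
    (hτ1 : ∀ t : ℝ, 0 < t → t < τ →
      t ^ C * (Real.logb 2 (1 / t)) ^ (2 * C) <
        (2 : ℝ) ^ (-(6 * (k : ℝ) * C)) * C ^ (-(2 * C)))
    (hτ2 : MonotoneOn (fun t : ℝ => t * (Real.logb 2 (1 / t)) ^ (2 * C)) (Set.Ioo 0 τ))
    (ε : ℝ) (hε0 : 0 < ε) (hετ : ε < τ)
    (n : ℕ) (hn : 0 < n) (X : Fin k → Finset (Fin n → ZMod p))
    (D : Finset (Fin k → (Fin n → ZMod p))) (hD : D ⊆ cycleSet k X)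
    (hdisj : ∀ c ∈ D, ∀ c' ∈ D, c ≠ c' → ∀ i, c i ≠ c' i)
    (hDcard : ε * (p : ℝ) ^ n ≤ (D.card : ℝ)) :
    (2 : ℝ) ^ (-(6 * (k : ℝ) * C)) * C ^ (-(2 * C)) * ε ^ C /
        (Real.logb 2 (1 / ε)) ^ (2 * C) * ((p : ℝ) ^ n) ^ (k - 1) ≤
      ((cycleSet k X).card : ℝ) := by
  obtain ⟨K, rfl⟩ : ∃ K, k = K + 1 := ⟨k - 1, by omega⟩
  have hp1 : (1 : ℝ) < p := by exact_mod_cast hp.out.one_lt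
  have hN : (p : ℝ) ^ n = Fintype.card (Fin n → ZMod p) := by
    simp [ZMod.card]
  have hN0 : (0 : ℝ) < (p : ℝ) ^ n := by positivity
  have hC₃ := two_le_of_bound p (H 3 le_rfl (by omega))
  have hCsum : C = Cconst p 3 + Cconst p K - 1 := by
    rw [hC, Cconst, Cconst, Cconst]
    push_cast
    ring
  have hC1 : 1 ≤ C := by
    have h1 : 1 ≤ 1 / cp3 p := by
      rw [Cconst] at hC₃
      norm_num at hC₃ ⊢
      linarith
    have h2 : C = ((K : ℝ) - 1) * (1 / cp3 p) + 1 := by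
      rw [hC, Cconst]; push_cast; ring
    have h3 : (3 : ℝ) ≤ K := by exact_mod_cast (by omega : 3 ≤ K)
    nlinarith
  have hC0 : 0 < C := by linarith
  have hD0 : D.Nonempty := by
    have : (0 : ℝ) < D.card := lt_of_lt_of_le (by positivity) hDcard
    exact Finset.card_pos.1 (by exact_mod_cast this)
  have hmain := le_card_cycleSet hN (by omega : 3 ≤ K)
    (fun δ h0 h1 Y hY => H 3 le_rfl (by omega) δ h0 h1 n hn Y hY)
    (fun δ h0 h1 Y hY => H K (by omega) (by omega) δ h0 h1 n hn Y hY)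
    hCsum hC1 hD0 hD hdisj
  refine le_trans ?_ hmain
  have hlog : 1 ≤ Real.logb 2 (1 / ε) := by
    rw [Real.le_logb_iff_rpow_le (by norm_num) (by positivity), Real.rpow_one,
      le_div_iff₀ hε0]
    linarith
  have hlogC : 1 ≤ (Real.logb 2 (1 / ε)) ^ (2 * C) := Real.one_le_rpow hlog (by positivity)
  rw [Nat.add_sub_cancel, mul_div_right_comm _ (((p : ℝ) ^ n) ^ K)]
  refine mul_le_mul_of_nonneg_right ?_ (by positivity)
  refine (div_le_self (by positivity) hlogC).trans ((const_rpow_le hk hC1 hε0).trans ?_)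
  refine div_le_div_of_nonneg_right (Real.rpow_le_rpow (by positivity) ?_ hC0.le) (by norm_num)
  rw [div_le_div_iff₀ (by positivity) (by positivity)]
  have h1 := mul_le_mul_of_nonneg_right hDcard
    (by positivity : (0 : ℝ) ≤ 16 * C * ((K + 1 : ℕ) : ℝ) ^ 2)
  linarith
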